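/- arXiv:1701.02316 — 3 statements merged into one kernel-verified Lean document; each statement's English description precedes it below -/
import Mathlib

section
/- (Projectors slide around nested caps) For every n ≥ 1: Ca_n ∘ (id^{⊗n} ⊗ t_n) = Ca_n ∘ (t_n ⊗ id^{⊗n}) as linear maps V^{⊗2n} → ℂ. -/
open Matrix

noncomputable section

/-- Sign strings `ε ∈ {+,-}^m`; `true` encodes `+` and `false` encodes `-`. -/
abbrev Sgn (m : ℕ) := Fin m → Bool

/-- Endomorphisms of `V^{⊗m}` (`V = ℂ²`), as matrices indexed by sign strings. -/
abbrev Op (m : ℕ) := Matrix (Sgn m) (Sgn m) ℂ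

/-- Linear maps `V^{⊗m} → V^{⊗n}`, as matrices (rows: target, columns: source). -/
abbrev Mor (m n : ℕ) := Matrix (Sgn n) (Sgn m) ℂ

/-- The basis vector `v_ε` of `V^{⊗m}`. -/
def bv {m : ℕ} (ε : Sgn m) : Sgn m → ℂ := fun δ => if δ = ε then 1 else 0

/-- The coefficient of `cap` on `v_a ⊗ v_b`:
`cap (v₋ ⊗ v₊) = 1`, `cap (v₊ ⊗ v₋) = -1`, `cap (v₊ ⊗ v₊) = cap (v₋ ⊗ v₋) = 0`. -/
def capc (a b : Bool) : ℂ := if a then (if b then 0 else -1) else (if b then 1 else 0)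

/-- The coefficient of `v_a ⊗ v_b` in `cup 1 = v₊ ⊗ v₋ - v₋ ⊗ v₊`. -/
def cupc (a b : Bool) : ℂ := if a then (if b then 0 else 1) else (if b then -1 else 0)

/-- The cap `V ⊗ V → ℂ`. -/
def capM : Mor 2 0 := Matrix.of fun _ ε => capc (ε 0) (ε 1)

/-- The cup `ℂ → V ⊗ V`. -/
def cupM : Mor 0 2 := Matrix.of fun δ _ => cupc (δ 0) (δ 1)

/-- The tensor product of two linear maps. -/
def tensMor {a b c d : ℕ} (A : Mor a b) (B : Mor c d) : Mor (a + c) (b + d) :=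
  Matrix.of fun δ ε =>
    A (fun i => δ (Fin.castAdd d i)) (fun i => ε (Fin.castAdd c i)) *
      B (fun j => δ (Fin.natAdd b j)) (fun j => ε (Fin.natAdd a j))

/-- The swap of the two tensor factors of `V ⊗ V`. -/
def swap2 : Op 2 := Matrix.of fun δ ε => if δ 0 = ε 1 ∧ δ 1 = ε 0 then 1 else 0

/-- `id^{⊗p} ⊗ A ⊗ id^{⊗(m-p-2)}`: the operator `A` on two strands placed at the
(0-based) positions `p`, `p+1` among `m` strands. -/
def atPos (m p : ℕ) (A : Op 2) : Op m :=
  Matrix.of fun δ ε =>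
    if h : p + 2 ≤ m then
      (if ∀ k : Fin m, k.val ≠ p → k.val ≠ p + 1 → δ k = ε k then 1 else 0) *
        A (fun i => δ ⟨p + i.val, Nat.lt_of_lt_of_le (Nat.add_lt_add_left i.isLt p) h⟩)
          (fun i => ε ⟨p + i.val, Nat.lt_of_lt_of_le (Nat.add_lt_add_left i.isLt p) h⟩)
    else 0

/-- Cyclic rotation of sign strings: `(rotIdx δ) k = δ (k+1 mod m)`. -/
def rotIdx {m : ℕ} (δ : Sgn m) : Sgn m := fun k => δ ⟨(k.val + 1) % m, Nat.mod_lt _ k.pos⟩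

/-- The rotation `d_m : V^{⊗m} → V^{⊗m}`, `d_m (v_ε ⊗ w) = i^{ε} (w ⊗ v_ε)`. -/
def dRot : (m : ℕ) → Op m
  | 0 => 1
  | (m + 1) =>
    Matrix.of fun δ' δ =>
      if δ' = rotIdx δ then (if δ 0 then Complex.I else -Complex.I) else 0

/-- The cap-cup generator `u_j` (`j` is 1-based, `1 ≤ j ≤ m-1`);
`u_0 := d_m⁻¹ ∘ u_1 ∘ d_m` is the affine generator. -/
def uFull (m j : ℕ) : Op m :=
  if j = 0 then (dRot m)⁻¹ * atPos m 0 (cupM * capM) * dRot m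
  else atPos m (j - 1) (cupM * capM)

/-- The extremal weight projectors `t_m`, defined by `t₁ = id`,
`t₂ = id + u₁/2 + u₀/2`, and `t_{m+1} = (t_m ⊗ id) ∘ σ_m ∘ (t_m ⊗ id)` for `m ≥ 2`
(with the convention `t₀ = 2·id`). -/
def tP : (m : ℕ) → Op m
  | 0 => (2 : ℂ) • 1
  | 1 => 1
  | 2 => 1 + (2⁻¹ : ℂ) • atPos 2 0 (cupM * capM) +
      (2⁻¹ : ℂ) • ((dRot 2)⁻¹ * atPos 2 0 (cupM * capM) * dRot 2)
  | (m + 3) =>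
    tensMor (tP (m + 2)) (1 : Op 1) * atPos (m + 3) (m + 1) swap2 *
      tensMor (tP (m + 2)) (1 : Op 1)

/-- `n` nested caps `Ca_n : V^{⊗2n} → ℂ`. -/
def CaM (n : ℕ) : Mor (n + n) 0 :=
  Matrix.of fun _ δ =>
    ∏ k : Fin n,
      capc (δ ⟨k.val, Nat.lt_of_lt_of_le k.isLt (Nat.le_add_right n n)⟩)
        (δ ⟨n + n - 1 - k.val,
          Nat.lt_of_le_of_lt (Nat.sub_le _ _)
            (Nat.sub_lt (Nat.lt_of_lt_of_le k.pos (Nat.le_add_right n n)) Nat.one_pos)⟩)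

/-- `n` nested cups `Cu_n : ℂ → V^{⊗2n}`. -/
def CuM (n : ℕ) : Mor 0 (n + n) :=
  Matrix.of fun δ _ =>
    ∏ k : Fin n,
      cupc (δ ⟨k.val, Nat.lt_of_lt_of_le k.isLt (Nat.le_add_right n n)⟩)
        (δ ⟨n + n - 1 - k.val,
          Nat.lt_of_le_of_lt (Nat.sub_le _ _)
            (Nat.sub_lt (Nat.lt_of_lt_of_le k.pos (Nat.le_add_right n n)) Nat.one_pos)⟩)

/-- The canonical identification of sign strings induced by an equality of lengths. -/
def sgnCast {a b : ℕ} (h : a = b) : Sgn a ≃ Sgn b :=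
  Equiv.arrowCongr (finCongr h) (Equiv.refl Bool)

/-- Reindexing of a linear map along equalities of the numbers of strands. -/
def rc {a b c d : ℕ} (h1 : a = b) (h2 : c = d) (A : Mor a c) : Mor b d :=
  Matrix.reindex (sgnCast h2) (sgnCast h1) A

/-- The idempotents `e_{m,n}`:
`e_{1,1} = -u₁/2 - d₂⁻¹ ∘ u₁ ∘ d₂ / 2` and
`e_{m,n} = -(t_m ⊗ t_n) ∘ u_m ∘ (t_m ⊗ t_n)` otherwise. -/
def eP : (m n : ℕ) → Op (m + n)
  | 1, 1 =>
    (-(2⁻¹ : ℂ)) • atPos 2 0 (cupM * capM) +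
      (-(2⁻¹ : ℂ)) • ((dRot 2)⁻¹ * atPos 2 0 (cupM * capM) * dRot 2)
  | m, n =>
    -(tensMor (tP m) (tP n) * atPos (m + n) (m - 1) (cupM * capM) * tensMor (tP m) (tP n))

lemma sum_sgn_two (f : Sgn 2 → ℂ) :
    ∑ δ, f δ = f ![true, true] + f ![true, false] + f ![false, true] + f ![false, false] := by
  rw [← (finTwoArrowEquiv Bool).symm.sum_comp, Fintype.sum_prod_type]
  simp [finTwoArrowEquiv, add_assoc]

lemma exists_sgn_two (δ : Sgn 2) : ∃ a b, δ = ![a, b] :=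
  ⟨δ 0, δ 1, by ext k; fin_cases k <;> rfl⟩

/-- The inverse of the rotation on two strands. -/
def dRotTwoInv : Op 2 :=
  Matrix.of fun δ δ' =>
    if δ' = rotIdx δ then (if δ 0 then -Complex.I else Complex.I) else 0

lemma rotIdx_two (a b : Bool) : rotIdx ![a, b] = ![b, a] := by
  ext k; fin_cases k <;> rfl

lemma inv_dRot_two : (dRot 2)⁻¹ = dRotTwoInv := by
  apply Matrix.inv_eq_right_inv
  ext δ ε
  obtain ⟨a, b, rfl⟩ := exists_sgn_two δ
  obtain ⟨c, d, rfl⟩ := exists_sgn_two ε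
  rw [Matrix.mul_apply, sum_sgn_two]
  simp only [dRot, dRotTwoInv, Matrix.of_apply, rotIdx_two, Matrix.one_apply]
  cases a <;> cases b <;> cases c <;> cases d <;> simp

lemma cup_cap_apply (a b c d : Bool) :
    atPos 2 0 (cupM * capM) ![a, b] ![c, d] = cupc a b * capc c d := by
  simp only [atPos, Matrix.of_apply, le_refl, zero_add, dif_pos, Matrix.mul_apply, cupM, capM,
    Finset.univ_unique, Finset.sum_singleton]
  rw [if_pos (by simp)]
  simp

/-- The projection of `V^{⊗m}` onto the span of the basis vectors with constant sign. -/
def constProj (m : ℕ) : Op m :=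
  Matrix.diagonal fun δ => if ∀ i j, δ i = δ j then 1 else 0

lemma tP_two : tP 2 = constProj 2 := by
  rw [tP, inv_dRot_two]
  ext δ ε
  obtain ⟨a, b, rfl⟩ := exists_sgn_two δ
  obtain ⟨c, d, rfl⟩ := exists_sgn_two ε
  simp only [Matrix.add_apply, Matrix.smul_apply, Matrix.mul_apply, sum_sgn_two, cup_cap_apply,
    dRot, dRotTwoInv, Matrix.of_apply, rotIdx_two, Matrix.one_apply, constProj,
    Matrix.diagonal_apply, Fin.forall_fin_two]
  cases a <;> cases b <;> cases c <;> cases d <;> simp [cupc, capc] <;> ring_nf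

lemma eq_iff_castAdd_natAdd {a b : ℕ} (δ ε : Sgn (a + b)) :
    δ = ε ↔ (fun i => δ (Fin.castAdd b i)) = (fun i => ε (Fin.castAdd b i)) ∧
      (fun i => δ (Fin.natAdd a i)) = (fun i => ε (Fin.natAdd a i)) := by
  constructor
  · rintro rfl; simp
  · rintro ⟨h1, h2⟩
    ext k
    refine Fin.addCases (fun i => congrFun h1 i) (fun i => congrFun h2 i) k

lemma tensMor_diagonal {a b : ℕ} (f : Sgn a → ℂ) (g : Sgn b → ℂ) :
    tensMor (Matrix.diagonal f) (Matrix.diagonal g) =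
      Matrix.diagonal fun δ : Sgn (a + b) =>
        f (fun i => δ (Fin.castAdd b i)) * g (fun i => δ (Fin.natAdd a i)) := by
  ext δ ε
  simp only [tensMor, Matrix.of_apply, Matrix.diagonal_apply, eq_iff_castAdd_natAdd δ ε]
  split_ifs <;> simp_all

lemma tP_succ_eq_constProj (m : ℕ) : tP (m + 1) = constProj (m + 1) := by
  match m with
  | 0 =>
    rw [tP, constProj, ← Matrix.diagonal_one]
    congr 1
    ext δ
    simp
  | 1 => exact tP_two
  | m + 2 =>
    rw [tP, tP_succ_eq_constProj (m + 1), constProj, ← Matrix.diagonal_one (n := Sgn 1),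
      tensMor_diagonal]
    ext δ ε
    rw [Matrix.mul_diagonal, Matrix.diagonal_mul, constProj, Matrix.diagonal_apply]
    simp only [atPos, Matrix.of_apply, swap2, mul_one]
    rw [dif_pos (by omega)]
    simp only [Fin.val_zero, Fin.val_one, add_zero]
    by_cases h : δ = ε ∧ ∀ i j, δ i = δ j
    · obtain ⟨rfl, h⟩ := h
      have hl : ∀ i j : Fin (m + 2), δ (Fin.castAdd 1 i) = δ (Fin.castAdd 1 j) :=
        fun i j => h _ _
      have hs : δ ⟨m + 1, by omega⟩ = δ ⟨m + 1 + 1, by omega⟩ := h _ _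
      rw [if_pos rfl, if_pos h, if_pos hl, if_pos (fun _ _ _ => rfl), if_pos ⟨hs, hs.symm⟩,
        one_mul, one_mul, one_mul]
    · rw [show (if δ = ε then (if ∀ i j, δ i = δ j then (1 : ℂ) else 0) else 0) = 0 by
        rw [ite_eq_right_iff]
        exact fun hδ => if_neg fun hc => h ⟨hδ, hc⟩]
      by_contra hne
      simp only [mul_eq_zero, not_or, ite_eq_right_iff, not_forall] at hne
      obtain ⟨⟨⟨h1, -⟩, ⟨⟨h2, -⟩, ⟨⟨h3, h4⟩, -⟩⟩⟩, ⟨h5, -⟩⟩ := hne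
      have h0 : δ ⟨0, by omega⟩ = ε ⟨0, by omega⟩ := h2 _ (by simp) (by simp)
      have hδ : ∀ k (hk : k < m + 2), δ ⟨k, by omega⟩ = δ ⟨0, by omega⟩ :=
        fun k hk => h1 ⟨k, hk⟩ 0
      have hε : ∀ k (hk : k < m + 2), ε ⟨k, by omega⟩ = δ ⟨0, by omega⟩ :=
        fun k hk => (h5 ⟨k, hk⟩ 0).trans h0.symm
      have hδ' : ∀ k, δ k = δ ⟨0, by omega⟩ := by
        rintro ⟨k, hk⟩
        obtain hk' | rfl : k < m + 2 ∨ k = m + 1 + 1 := by omega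
        · exact hδ k hk'
        · exact h4.trans (hε _ (by omega))
      have hε' : ∀ k, ε k = δ ⟨0, by omega⟩ := by
        rintro ⟨k, hk⟩
        obtain hk' | rfl : k < m + 2 ∨ k = m + 1 + 1 := by omega
        · exact hε k hk'
        · exact h3.symm.trans (hδ _ (by omega))
      exact h ⟨funext fun k => (hδ' k).trans (hε' k).symm,
        fun i j => (hδ' i).trans (hδ' j).symm⟩

/-- Projectors slide around nested caps:
`Ca_n ∘ (id^{⊗n} ⊗ t_n) = Ca_n ∘ (t_n ⊗ id^{⊗n})`. -/
theorem projectors_slide_around_caps (n : ℕ) (hn : 1 ≤ n) :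
    CaM n * tensMor (1 : Op n) (tP n) = CaM n * tensMor (tP n) (1 : Op n) := by
  obtain ⟨m, rfl⟩ : ∃ m, n = m + 1 := ⟨n - 1, by omega⟩
  rw [tP_succ_eq_constProj, constProj, ← Matrix.diagonal_one, tensMor_diagonal, tensMor_diagonal]
  ext e δ
  rw [Matrix.mul_diagonal, Matrix.mul_diagonal]
  by_cases hc : CaM (m + 1) e δ = 0
  · rw [hc, zero_mul, zero_mul]
  have key : ∀ k : Fin (m + 1),
      δ (Fin.natAdd (m + 1) k.rev) = !δ (Fin.castAdd (m + 1) k) := by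
    intro k
    have hk := hc
    rw [CaM, Matrix.of_apply, Finset.prod_eq_zero_iff] at hk
    replace hk := fun h0 => hk ⟨k, Finset.mem_univ k, h0⟩
    have e1 : (⟨m + 1 + (m + 1) - 1 - k.val, by omega⟩ : Fin (m + 1 + (m + 1)))
        = Fin.natAdd (m + 1) k.rev := by
      ext; simp [Fin.rev]; omega
    rw [e1] at hk
    change capc (δ (Fin.castAdd (m + 1) k)) (δ (Fin.natAdd (m + 1) k.rev)) ≠ 0 at hk
    revert hk
    cases δ (Fin.castAdd (m + 1) k) <;> cases δ (Fin.natAdd (m + 1) k.rev) <;> simp [capc]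
  have hiff : (∀ i j : Fin (m + 1), δ (Fin.natAdd (m + 1) i) = δ (Fin.natAdd (m + 1) j)) ↔
      ∀ i j : Fin (m + 1), δ (Fin.castAdd (m + 1) i) = δ (Fin.castAdd (m + 1) j) := by
    constructor
    · intro h i j
      have hij := h i.rev j.rev
      rwa [key, key, Bool.not_inj_iff] at hij
    · intro h i j
      rw [← Fin.rev_rev i, ← Fin.rev_rev j, key, key, h]
  simp only [hiff, one_mul, mul_one]
end
end

section
/- (Overlapping projectors combine) For all 1 ≤ n ≤ m and 0 ≤ r < n, the following hold in End(V^{⊗(m+r)}): (t_m ⊗ id^{⊗r}) ∘ (id^{⊗(m−n+r)} ⊗ t_n) = t_{m+r} = (id^{⊗(m−n+r)} ⊗ t_n) ∘ (t_m ⊗ id^{⊗r}), and likewise (id^{⊗r} ⊗ t_m) ∘ (t_n ⊗ id^{⊗(m−n+r)}) = t_{m+r} = (t_n ⊗ id^{⊗(m−n+r)}) ∘ (id^{⊗r} ⊗ t_m). -/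
open Matrix

noncomputable section

/-- The diagonal matrix whose entries are the indicator of a predicate on sign strings. -/
def indDiag {m : ℕ} (p : Sgn m → Prop) : Op m :=
  open scoped Classical in Matrix.diagonal fun ε => if p ε then 1 else 0

theorem indDiag_true {m : ℕ} : indDiag (fun _ : Sgn m => True) = 1 := by
  simp [indDiag]

theorem indDiag_mul {m : ℕ} (p q : Sgn m → Prop) :
    indDiag p * indDiag q = indDiag fun ε => p ε ∧ q ε := by
  classical
  simp only [indDiag, Matrix.diagonal_mul_diagonal]
  congr 1
  ext ε
  by_cases hp : p ε <;> by_cases hq : q ε <;> simp [hp, hq]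

theorem rc_indDiag {a b : ℕ} (h h' : a = b) (p : Sgn a → Prop) :
    rc h h' (indDiag p) = indDiag fun ε => p fun i => ε (Fin.cast h i) := by
  subst h
  rfl

theorem tensMor_indDiag {a b : ℕ} (p : Sgn a → Prop) (q : Sgn b → Prop) :
    tensMor (indDiag p) (indDiag q) = indDiag fun ε : Sgn (a + b) =>
      p (fun i => ε (Fin.castAdd b i)) ∧ q (fun j => ε (Fin.natAdd a j)) := by
  classical
  ext δ ε
  have key : δ = ε ↔ (fun i => δ (Fin.castAdd b i)) = (fun i => ε (Fin.castAdd b i)) ∧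
      (fun j => δ (Fin.natAdd a j)) = (fun j => ε (Fin.natAdd a j)) := by
    refine ⟨by rintro rfl; simp, fun ⟨h1, h2⟩ => funext fun k => ?_⟩
    induction k using Fin.addCases with
    | left i => exact congrFun h1 i
    | right j => exact congrFun h2 j
  simp only [tensMor, indDiag, Matrix.of_apply, Matrix.diagonal_apply, key]
  split_ifs <;> simp_all

/-- A sign string all of whose signs agree. -/
def IsConst {m : ℕ} (ε : Sgn m) : Prop := ∀ i j, ε i = ε j

theorem atPos_zero_two (A : Op 2) : atPos 2 0 A = A := by
  ext δ ε
  simp [atPos]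

theorem dRot_two_inv :
    (dRot 2)⁻¹ = Matrix.of fun δ δ' : Sgn 2 =>
      if δ' = rotIdx δ then (if δ 0 then -Complex.I else Complex.I) else 0 := by
  apply Matrix.inv_eq_left_inv
  ext δ ε
  have hinj : rotIdx δ = rotIdx ε ↔ δ = ε := by
    simp only [funext_iff, Fin.forall_fin_two, rotIdx]
    exact and_comm
  simp only [Matrix.mul_apply, dRot, Matrix.of_apply, ite_mul, zero_mul,
    Finset.sum_ite_eq', Finset.mem_univ, if_true, hinj, Matrix.one_apply]
  by_cases h : δ = ε
  · subst h
    cases δ 0 <;> simp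
  · simp [h]

theorem dRot_two_conj_apply (A : Op 2) (δ ε : Sgn 2) :
    ((dRot 2)⁻¹ * A * dRot 2) δ ε =
      (if δ 0 then -Complex.I else Complex.I) * A (rotIdx δ) (rotIdx ε) *
        (if ε 0 then Complex.I else -Complex.I) := by
  rw [dRot_two_inv]
  simp [Matrix.mul_apply, dRot]

theorem tP_two_s14 : tP 2 = indDiag IsConst := by
  classical
  ext δ ε
  have hc : IsConst δ ↔ δ 0 = δ 1 := by
    simp only [IsConst, Fin.forall_fin_two]
    grind
  have hr (η : Sgn 2) : rotIdx η 0 = η 1 ∧ rotIdx η 1 = η 0 := ⟨rfl, rfl⟩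
  have he : δ = ε ↔ δ 0 = ε 0 ∧ δ 1 = ε 1 := by
    simp only [funext_iff, Fin.forall_fin_two]
  have hu (α β : Sgn 2) : (cupM * capM) α β = cupc (α 0) (α 1) * capc (β 0) (β 1) := by
    simp [Matrix.mul_apply, cupM, capM]
  rw [tP, atPos_zero_two]
  simp only [Matrix.add_apply, Matrix.smul_apply, dRot_two_conj_apply, hu, indDiag,
    Matrix.diagonal_apply, hc, he, Matrix.one_apply, (hr _).1, (hr _).2]
  cases δ 0 <;> cases δ 1 <;> cases ε 0 <;> cases ε 1 <;>
    simp [cupc, capc] <;> norm_num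

/-- The extremal weight projector is the projection onto the two constant sign strings. -/
theorem tP_eq_indDiag : ∀ m : ℕ, tP (m + 1) = indDiag IsConst
  | 0 => by
    rw [tP, ← indDiag_true]
    congr
    ext ε
    simp [IsConst, Fin.forall_fin_one]
  | 1 => tP_two_s14
  | m + 2 => by
    classical
    rw [tP, tP_eq_indDiag (m + 1), ← indDiag_true, tensMor_indDiag]
    ext δ ε
    simp only [indDiag, Matrix.diagonal_mul, Matrix.mul_diagonal, Matrix.diagonal_apply, and_true]
    have hlast (η : Sgn (m + 3)) (h : IsConst fun i : Fin (m + 2) => η (Fin.castAdd 1 i)) :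
        ∀ k : Fin (m + 3), k.val < m + 2 → η k = η 0 := fun k hk => h ⟨k, hk⟩ 0
    have hres (η : Sgn (m + 3)) (h : IsConst η) :
        IsConst fun i : Fin (m + 2) => η (Fin.castAdd 1 i) := fun i j => h _ _
    by_cases hδ : IsConst fun i : Fin (m + 2) => δ (Fin.castAdd 1 i)
    · by_cases hε : IsConst fun i : Fin (m + 2) => ε (Fin.castAdd 1 i)
      · have hS : atPos (m + 3) (m + 1) swap2 δ ε = if δ = ε ∧ IsConst δ then 1 else 0 := by
          simp only [atPos, swap2, Matrix.of_apply, le_refl, dite_true, mul_ite, mul_one, mul_zero]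
          rw [← ite_and]
          refine if_congr ?_ rfl rfl
          constructor
          · rintro ⟨⟨h1, h2⟩, h3⟩
            have h0 : δ 0 = ε 0 := h3 0 (by simp) (by simp)
            have d1 := hlast δ hδ ⟨m + 1, by omega⟩ (by simp)
            have e1 := hlast ε hε ⟨m + 1, by omega⟩ (by simp)
            have hd : ∀ k, δ k = δ 0 := fun k => by
              rcases Nat.lt_or_ge k.val (m + 2) with hk | hk
              · exact hlast δ hδ k hk
              · rw [show k = ⟨m + 2, Nat.lt_succ_self _⟩ from Fin.ext (by simp; omega)]
                exact h2.trans (e1.trans h0.symm)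
            have he : ∀ k, ε k = ε 0 := fun k => by
              rcases Nat.lt_or_ge k.val (m + 2) with hk | hk
              · exact hlast ε hε k hk
              · rw [show k = ⟨m + 2, Nat.lt_succ_self _⟩ from Fin.ext (by simp; omega)]
                exact h1.symm.trans (d1.trans h0)
            exact ⟨funext fun k => (hd k).trans (h0.trans (he k).symm),
              fun i j => (hd i).trans (hd j).symm⟩
          · rintro ⟨rfl, h⟩
            exact ⟨⟨h _ _, h _ _⟩, fun _ _ _ => rfl⟩
        rw [hS, if_pos hδ, if_pos hε, ite_and]
        simp
      · have : δ = ε → ¬ IsConst δ := by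
          rintro rfl h
          exact hε (hres _ h)
        rw [if_neg hε, mul_zero, ← ite_and, if_neg fun h => this h.1 h.2]
    · rw [if_neg hδ, zero_mul, zero_mul, ← ite_and, if_neg fun h => hδ (hres _ h.2)]

theorem IsConst.of_overlap {m : ℕ} {ε : Sgn m} (c : Fin m) {p q : Fin m → Prop}
    (hp : ∀ i, p i → ε i = ε c) (hq : ∀ i, q i → ε i = ε c) (hpq : ∀ i, p i ∨ q i) :
    IsConst ε := by
  have h : ∀ i, ε i = ε c := fun i => (hpq i).elim (hp i) (hq i)
  exact fun i j => (h i).trans (h j).symm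

/-- Overlapping projectors combine: for `1 ≤ n ≤ m`, `0 ≤ r < n`. -/
theorem overlapping_projectors (m n r : ℕ) (hn : 1 ≤ n) (hnm : n ≤ m) (hr : r < n) :
    (tensMor (tP m) (1 : Op r) *
        (rc (by omega) (by omega) (tensMor (1 : Op (m - n + r)) (tP n)) : Op (m + r)) =
      tP (m + r) ∧
      (rc (by omega) (by omega) (tensMor (1 : Op (m - n + r)) (tP n)) : Op (m + r)) *
          tensMor (tP m) (1 : Op r) =
        tP (m + r)) ∧
    ((rc (by omega) (by omega) (tensMor (1 : Op r) (tP m)) : Op (m + r)) *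
        (rc (by omega) (by omega) (tensMor (tP n) (1 : Op (m - n + r))) : Op (m + r)) =
      tP (m + r) ∧
      (rc (by omega) (by omega) (tensMor (tP n) (1 : Op (m - n + r))) : Op (m + r)) *
          (rc (by omega) (by omega) (tensMor (1 : Op r) (tP m)) : Op (m + r)) =
        tP (m + r)) := by
  obtain ⟨m, rfl⟩ : ∃ k, m = k + 1 := ⟨m - 1, by omega⟩
  obtain ⟨n, rfl⟩ : ∃ k, n = k + 1 := ⟨n - 1, by omega⟩
  have ht : tP (m + 1 + r) = indDiag IsConst := by
    obtain ⟨k, hk⟩ : ∃ k, m + 1 + r = k + 1 := ⟨m + r, by omega⟩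
    rw [hk, tP_eq_indDiag]
  have hl : m + 1 - (n + 1) + r + (n + 1) = m + 1 + r := by omega
  have hl' : n + 1 + (m + 1 - (n + 1) + r) = m + 1 + r := by omega
  have hleft (ε : Sgn (m + 1 + r)) :
      (IsConst (fun i : Fin (m + 1) => ε (Fin.castAdd r i)) ∧
        IsConst (fun j : Fin (n + 1) =>
          ε (Fin.cast hl (Fin.natAdd (m + 1 - (n + 1) + r) j)))) ↔ IsConst ε := by
    refine ⟨fun ⟨h1, h2⟩ => ?_, fun h => ⟨fun _ _ => h _ _, fun _ _ => h _ _⟩⟩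
    refine IsConst.of_overlap ⟨m, by omega⟩ (p := fun i => i.val < m + 1)
      (q := fun i => m - n + r ≤ i.val) (fun i hi => h1 ⟨i, hi⟩ ⟨m, by omega⟩)
      (fun i hi => ?_) (fun i => by omega)
    convert h2 ⟨i - (m - n + r), by omega⟩ ⟨m - (m - n + r), by omega⟩ using 2 <;>
      ext <;> simp <;> omega
  have hright (ε : Sgn (m + 1 + r)) :
      (IsConst (fun j : Fin (m + 1) => ε (Fin.cast (Nat.add_comm _ _) (Fin.natAdd r j))) ∧
        IsConst (fun i : Fin (n + 1) =>
          ε (Fin.cast hl' (Fin.castAdd (m + 1 - (n + 1) + r) i)))) ↔ IsConst ε := by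
    refine ⟨fun ⟨h1, h2⟩ => ?_, fun h => ⟨fun _ _ => h _ _, fun _ _ => h _ _⟩⟩
    refine IsConst.of_overlap ⟨r, by omega⟩ (p := fun i => r ≤ i.val)
      (q := fun i => i.val < n + 1) (fun i hi => ?_)
      (fun i hi => h2 ⟨i, hi⟩ ⟨r, hr⟩) (fun i => by omega)
    convert h1 ⟨i - r, by omega⟩ 0 using 2 <;> ext <;> simp <;> omega
  simp only [ht, tP_eq_indDiag, ← indDiag_true, tensMor_indDiag, rc_indDiag, indDiag_mul,
    true_and, and_true]
  refine ⟨⟨?_, ?_⟩, ?_, ?_⟩ <;> congr 1 <;> ext ε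
  · exact hleft ε
  · exact and_comm.trans (hleft ε)
  · exact hright ε
  · exact and_comm.trans (hright ε)
end
end

section
/- (Partial trace formula for Jones-Wenzl projectors) For every m ≥ 2: (id^{⊗(m−1)} ⊗ cap) ∘ (p_m ⊗ id_V) ∘ (id^{⊗(m−1)} ⊗ cup) = −((m+1)/m) · p_{m−1} in End(V^{⊗(m−1)}). -/
open Matrix

noncomputable section

/-- The Jones-Wenzl projectors `p_m`, defined recursively by `p₁ = id` and
`p_{m+1} = p_m ⊗ id + (m/(m+1)) (p_m ⊗ id) ∘ u_m ∘ (p_m ⊗ id)`. -/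
def pJW : (m : ℕ) → Op m
  | 0 => 1
  | 1 => 1
  | (m + 2) =>
    tensMor (pJW (m + 1)) (1 : Op 1) +
      (((m : ℂ) + 1) / ((m : ℂ) + 2)) •
        (tensMor (pJW (m + 1)) (1 : Op 1) * atPos (m + 2) m (cupM * capM) *
          tensMor (pJW (m + 1)) (1 : Op 1))

theorem tensMor_mul {a b c d e f : ℕ} (A : Mor b c) (B : Mor a b) (C : Mor e f) (D : Mor d e) :
    tensMor (A * B) (C * D) = tensMor A C * tensMor B D := by
  ext δ ε
  simp only [tensMor, Matrix.of_apply, Matrix.mul_apply]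
  rw [Finset.sum_mul_sum, ← Fintype.sum_prod_type',
    ← (Fin.appendEquiv (α := Bool) b e).sum_comp]
  refine Finset.sum_congr rfl fun x _ => ?_
  simp only [Fin.appendEquiv, Equiv.coe_fn_mk, Fin.append_left, Fin.append_right]
  ring

theorem tensMor_one {a b : ℕ} : tensMor (1 : Op a) (1 : Op b) = 1 := by
  ext δ ε
  simp only [tensMor, Matrix.of_apply, Matrix.one_apply, ite_zero_mul_ite_zero, mul_one]
  congr 1
  refine propext ⟨fun h => ?_, fun h => by simp [h]⟩
  funext i
  refine Fin.addCases (fun i => ?_) (fun i => ?_) i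
  · exact congrFun h.1 i
  · exact congrFun h.2 i

theorem tensMor_add {a b c d : ℕ} (A B : Mor a b) (C : Mor c d) :
    tensMor (A + B) C = tensMor A C + tensMor B C := by
  ext δ ε
  simp [tensMor, add_mul]

theorem tensMor_smul {a b c d : ℕ} (r : ℂ) (A : Mor a b) (C : Mor c d) :
    tensMor (r • A) C = r • tensMor A C := by
  ext δ ε
  simp [tensMor, mul_assoc]

theorem tensMor_one_zero {a b : ℕ} (A : Mor a b) : tensMor A (1 : Op 0) = A := by
  ext δ ε
  rw [tensMor, Matrix.of_apply, Matrix.one_apply, if_pos (Subsingleton.elim _ _), mul_one]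
  rfl

theorem tensMor_tensMor_one {k : ℕ} (A : Op k) :
    tensMor (tensMor A (1 : Op 1)) (1 : Op 1) = tensMor A (1 : Op 2) := by
  rw [← tensMor_one (a := 1) (b := 1)]
  ext δ ε
  simp only [tensMor, Matrix.of_apply, mul_assoc]
  refine congrArg₂ _ rfl (congrArg₂ _ rfl (congrArg₂ _ ?_ ?_)) <;> funext j
  · exact congrArg δ (Fin.ext (Nat.add_assoc _ _ _))
  · exact congrArg ε (Fin.ext (Nat.add_assoc _ _ _))

/-- Caps the last two strands. -/
def capLast (k : ℕ) : Mor (k + 2) k := tensMor (1 : Op k) capM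

/-- Creates a cup to the right of `k` strands. -/
def cupLast (k : ℕ) : Mor k (k + 2) := tensMor (1 : Op k) cupM

theorem cupLast_mul {k : ℕ} (A : Op k) :
    cupLast k * A = tensMor (tensMor A (1 : Op 1)) (1 : Op 1) * cupLast k := by
  have h1 := tensMor_mul (1 : Op k) A cupM (1 : Op 0)
  have h2 := tensMor_mul A (1 : Op k) (1 : Op 2) cupM
  rw [tensMor_one_zero A] at h1
  rw [tensMor_tensMor_one]
  simp only [Matrix.one_mul, Matrix.mul_one] at h1 h2
  exact h1.symm.trans h2

theorem capLast_mul {k : ℕ} (A : Op k) :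
    capLast k * tensMor (tensMor A (1 : Op 1)) (1 : Op 1) = A * capLast k := by
  have h1 := tensMor_mul A (1 : Op k) (1 : Op 0) capM
  have h2 := tensMor_mul (1 : Op k) A capM (1 : Op 2)
  rw [tensMor_one_zero A] at h1
  rw [tensMor_tensMor_one]
  simp only [Matrix.one_mul, Matrix.mul_one] at h1 h2
  exact h2.symm.trans h1

theorem atPos_cup_cap (k : ℕ) : atPos (k + 2) k (cupM * capM) = cupLast k * capLast k := by
  have h := tensMor_mul (1 : Op k) (1 : Op k) cupM capM
  rw [Matrix.one_mul] at h
  refine Eq.trans ?_ h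
  ext δ ε
  simp only [atPos, tensMor, Matrix.of_apply, le_refl, dite_true, Matrix.one_apply]
  congr 1
  congr 1
  refine propext ⟨fun h => ?_, fun h i h1 h2 => ?_⟩
  · funext i
    exact h _ (by simp; omega) (by simp; omega)
  · exact congrFun h ⟨i, by omega⟩

theorem sum_sgn_succ {n : ℕ} (f : Sgn (n + 1) → ℂ) :
    ∑ x, f x = ∑ b, ∑ y : Sgn n, f (Fin.cons b y) := by
  rw [← (Fin.consEquiv fun _ : Fin (n + 1) => Bool).sum_comp, Fintype.sum_prod_type]
  rfl

theorem capLast_mul_cupLast (k : ℕ) : capLast k * cupLast k = (-2 : ℂ) • (1 : Op k) := by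
  have h := tensMor_mul (1 : Op k) (1 : Op k) capM cupM
  have e : capM * cupM = (-2 : ℂ) • (1 : Op 0) := by
    ext δ ε
    rw [Subsingleton.elim δ ε]
    rw [Matrix.mul_apply]
    simp only [sum_sgn_succ]
    simp [capM, cupM, capc, cupc]
    norm_num
  rw [Matrix.one_mul, e] at h
  refine h.symm.trans ?_
  ext δ ε
  have h1 := congrFun (congrFun (tensMor_one (a := k) (b := 0)) δ) ε
  simp only [tensMor, Matrix.of_apply, Matrix.smul_apply, smul_eq_mul] at h1 ⊢
  rw [mul_left_comm, h1]

/-- `id ⊗ cap` on three strands. -/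
def idCap : Mor 3 1 := tensMor (1 : Op 1) capM

/-- `id ⊗ cup` on three strands. -/
def idCup : Mor 1 3 := tensMor (1 : Op 1) cupM

/-- `cap ⊗ id` on three strands. -/
def capId : Mor 3 1 := tensMor capM (1 : Op 1)

/-- `cup ⊗ id` on three strands. -/
def cupId : Mor 1 3 := tensMor cupM (1 : Op 1)

theorem sum_sgn_three (f : Sgn 3 → ℂ) : ∑ x, f x = ∑ a, ∑ b, ∑ c, f ![a, b, c] := by
  simp only [sum_sgn_succ, Fintype.sum_unique]
  rfl

theorem idCap_mul_cupId : idCap * cupId = 1 := by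
  have h1 : ∀ (δ : Sgn 1) a b c, idCap δ ![a, b, c] = (if δ 0 = a then 1 else 0) * capc b c := by
    intro δ a b c
    simp only [idCap, tensMor, Matrix.of_apply, Matrix.one_apply, funext_iff, Fin.forall_fin_one]
    rfl
  have h2 : ∀ (ε : Sgn 1) a b c, cupId ![a, b, c] ε = cupc a b * (if c = ε 0 then 1 else 0) := by
    intro ε a b c
    simp only [cupId, tensMor, Matrix.of_apply, Matrix.one_apply, funext_iff, Fin.forall_fin_one]
    rfl
  ext δ ε
  simp only [Matrix.mul_apply, sum_sgn_three, Fintype.sum_bool, h1, h2, Matrix.one_apply,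
    funext_iff, Fin.forall_fin_one]
  cases δ 0 <;> cases ε 0 <;> simp [capc, cupc]

theorem capId_mul_idCup : capId * idCup = 1 := by
  have h1 : ∀ (δ : Sgn 1) a b c, capId δ ![a, b, c] = capc a b * (if δ 0 = c then 1 else 0) := by
    intro δ a b c
    simp only [capId, tensMor, Matrix.of_apply, Matrix.one_apply, funext_iff, Fin.forall_fin_one]
    rfl
  have h2 : ∀ (ε : Sgn 1) a b c, idCup ![a, b, c] ε = (if a = ε 0 then 1 else 0) * cupc b c := by
    intro ε a b c
    simp only [idCup, tensMor, Matrix.of_apply, Matrix.one_apply, funext_iff, Fin.forall_fin_one]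
    rfl
  ext δ ε
  simp only [Matrix.mul_apply, sum_sgn_three, Fintype.sum_bool, h1, h2, Matrix.one_apply,
    funext_iff, Fin.forall_fin_one]
  cases δ 0 <;> cases ε 0 <;> simp [capc, cupc]

theorem capLast_succ (k : ℕ) : capLast (k + 1) = tensMor (1 : Op k) idCap := by
  rw [capLast, ← tensMor_one (a := k) (b := 1)]
  ext δ ε
  simp only [idCap, tensMor, Matrix.of_apply, mul_assoc]
  refine congrArg₂ _ rfl (congrArg₂ _ rfl (congrArg₂ _ ?_ ?_))
  · exact Subsingleton.elim _ _
  · funext j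
    exact congrArg ε (Fin.ext (Nat.add_assoc _ _ _))

theorem cupLast_succ (k : ℕ) : cupLast (k + 1) = tensMor (1 : Op k) idCup := by
  rw [cupLast, ← tensMor_one (a := k) (b := 1)]
  ext δ ε
  simp only [idCup, tensMor, Matrix.of_apply, mul_assoc]
  refine congrArg₂ _ rfl (congrArg₂ _ rfl (congrArg₂ _ ?_ ?_))
  · funext j
    exact congrArg δ (Fin.ext (Nat.add_assoc _ _ _))
  · exact Subsingleton.elim _ _

theorem tensMor_capLast (k : ℕ) : tensMor (capLast k) (1 : Op 1) = tensMor (1 : Op k) capId := by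
  ext δ ε
  simp only [capLast, capId, tensMor, Matrix.of_apply, mul_assoc]
  refine congrArg₂ _ rfl (congrArg₂ _ rfl (congrArg₂ _ ?_ ?_)) <;> funext j
  · exact congrArg δ (Fin.ext (by simp))
  · exact congrArg ε (Fin.ext (Nat.add_assoc _ _ _))

theorem tensMor_cupLast (k : ℕ) : tensMor (cupLast k) (1 : Op 1) = tensMor (1 : Op k) cupId := by
  ext δ ε
  simp only [cupLast, cupId, tensMor, Matrix.of_apply, mul_assoc]
  refine congrArg₂ _ rfl (congrArg₂ _ rfl (congrArg₂ _ ?_ ?_)) <;> funext j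
  · exact congrArg δ (Fin.ext (Nat.add_assoc _ _ _))
  · exact congrArg ε (Fin.ext (by simp))

theorem capLast_mul_tensMor_cupLast (k : ℕ) :
    capLast (k + 1) * tensMor (cupLast k) (1 : Op 1) = 1 := by
  have h := tensMor_mul (1 : Op k) (1 : Op k) idCap cupId
  rw [idCap_mul_cupId, Matrix.one_mul, tensMor_one] at h
  rw [capLast_succ, tensMor_cupLast]
  exact h.symm

theorem tensMor_capLast_mul_cupLast (k : ℕ) :
    tensMor (capLast k) (1 : Op 1) * cupLast (k + 1) = 1 := by
  have h := tensMor_mul (1 : Op k) (1 : Op k) capId idCup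
  rw [capId_mul_idCup, Matrix.one_mul, tensMor_one] at h
  rw [cupLast_succ, tensMor_capLast]
  exact h.symm

/-- Adds a strand on the right. -/
def addStrand {a b : ℕ} (A : Mor a b) : Mor (a + 1) (b + 1) := tensMor A (1 : Op 1)

theorem addStrand_mul {a b c : ℕ} (A : Mor b c) (B : Mor a b) :
    addStrand (A * B) = addStrand A * addStrand B := by
  simpa [addStrand] using tensMor_mul A B (1 : Op 1) (1 : Op 1)

theorem pJW_add_two (k : ℕ) :
    pJW (k + 2) = addStrand (pJW (k + 1)) + (((k : ℂ) + 1) / ((k : ℂ) + 2)) •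
      (addStrand (pJW (k + 1)) * (cupLast k * capLast k) * addStrand (pJW (k + 1))) := by
  rw [← atPos_cup_cap]
  rfl

theorem partialTrace_pJW_of_idempotent (k : ℕ) (h : pJW (k + 1) * pJW (k + 1) = pJW (k + 1)) :
    capLast (k + 1) * addStrand (pJW (k + 2)) * cupLast (k + 1) =
      (-(((k : ℂ) + 3) / ((k : ℂ) + 2))) • pJW (k + 1) := by
  have hk : (k : ℂ) + 2 ≠ 0 := by exact_mod_cast (k + 1).succ_ne_zero
  have h1 : capLast (k + 1) * addStrand (addStrand (pJW (k + 1))) = pJW (k + 1) * capLast (k + 1) :=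
    capLast_mul _
  have h2 : cupLast (k + 1) * pJW (k + 1) = addStrand (addStrand (pJW (k + 1))) * cupLast (k + 1) :=
    cupLast_mul _
  have h3 : capLast (k + 1) * addStrand (cupLast k) = 1 := capLast_mul_tensMor_cupLast k
  have h4 : addStrand (capLast k) * cupLast (k + 1) = 1 := tensMor_capLast_mul_cupLast k
  have h5 : addStrand (pJW (k + 2)) = addStrand (addStrand (pJW (k + 1))) +
      (((k : ℂ) + 1) / ((k : ℂ) + 2)) • (addStrand (addStrand (pJW (k + 1))) *
        (addStrand (cupLast k) * addStrand (capLast k)) * addStrand (addStrand (pJW (k + 1)))) := by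
    rw [pJW_add_two, ← addStrand_mul, ← addStrand_mul, ← addStrand_mul]
    exact (tensMor_add _ _ _).trans (congrArg _ (tensMor_smul _ _ _))
  have h6 : capLast (k + 1) * (addStrand (addStrand (pJW (k + 1))) *
      (addStrand (cupLast k) * addStrand (capLast k)) * addStrand (addStrand (pJW (k + 1)))) *
        cupLast (k + 1) = pJW (k + 1) := by
    calc _ = (capLast (k + 1) * addStrand (addStrand (pJW (k + 1)))) * addStrand (cupLast k) *
          (addStrand (capLast k) * (addStrand (addStrand (pJW (k + 1))) * cupLast (k + 1))) := by
          simp only [Matrix.mul_assoc]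
      _ = pJW (k + 1) * (capLast (k + 1) * addStrand (cupLast k)) *
          ((addStrand (capLast k) * cupLast (k + 1)) * pJW (k + 1)) := by
          rw [h1, ← h2]
          simp only [Matrix.mul_assoc]
      _ = pJW (k + 1) := by rw [h3, h4, Matrix.mul_one, Matrix.one_mul, h]
  rw [h5, Matrix.mul_add, Matrix.add_mul, h1, Matrix.mul_assoc, capLast_mul_cupLast,
    Matrix.mul_smul, Matrix.mul_one, Matrix.mul_smul, Matrix.smul_mul, h6, ← add_smul]
  congr 1
  field_simp
  ring

theorem pJW_idempotent_and_absorb_and_partialTrace (k : ℕ) :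
    pJW (k + 1) * pJW (k + 1) = pJW (k + 1) ∧
      pJW (k + 1) * addStrand (pJW k) = pJW (k + 1) ∧
      capLast k * addStrand (pJW (k + 1)) * cupLast k =
        (-(((k : ℂ) + 2) / ((k : ℂ) + 1))) • pJW k := by
  induction k with
  | zero =>
    have h : addStrand (1 : Op 0) = (1 : Op 1) := tensMor_one
    have h' : addStrand (1 : Op 1) = (1 : Op 2) := tensMor_one
    refine ⟨Matrix.one_mul _, ?_, ?_⟩
    · exact (congrArg _ h).trans (Matrix.mul_one _)
    · have e := capLast_mul_cupLast 0
      simp only [pJW, zero_add, Nat.cast_zero, div_one]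
      rw [h', Matrix.mul_one, e]
  | succ k ih =>
    obtain ⟨hi, ha, ht⟩ := ih
    have hk : (k : ℂ) + 2 ≠ 0 := by exact_mod_cast (k + 1).succ_ne_zero
    have hk' : (k : ℂ) + 1 ≠ 0 := by exact_mod_cast k.succ_ne_zero
    have hP : addStrand (pJW (k + 1)) * addStrand (pJW (k + 1)) = addStrand (pJW (k + 1)) := by
      rw [← addStrand_mul, hi]
    have hA : addStrand (pJW (k + 1)) * addStrand (addStrand (pJW k)) =
        addStrand (pJW (k + 1)) := by
      rw [← addStrand_mul, ha]
    have hC : cupLast k * pJW k = addStrand (addStrand (pJW k)) * cupLast k := cupLast_mul _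
    have ht' := partialTrace_pJW_of_idempotent k hi
    have hp := pJW_add_two k
    have habs : pJW (k + 2) * addStrand (pJW (k + 1)) = pJW (k + 2) := by
      rw [hp, Matrix.add_mul, hP, Matrix.smul_mul, Matrix.mul_assoc _ _ (addStrand _), hP]
    refine ⟨?_, habs, ?_⟩
    · have hPC : addStrand (pJW (k + 1)) * (cupLast k * pJW k) =
          addStrand (pJW (k + 1)) * cupLast k := by
        rw [hC, ← Matrix.mul_assoc, hA]
      have hann : pJW (k + 2) * cupLast k = 0 := by
        have e : addStrand (pJW (k + 1)) * (cupLast k * capLast k) * addStrand (pJW (k + 1)) *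
            cupLast k = addStrand (pJW (k + 1)) *
              (cupLast k * (capLast k * addStrand (pJW (k + 1)) * cupLast k)) := by
          simp only [Matrix.mul_assoc]
        rw [hp, Matrix.add_mul, Matrix.smul_mul, e, ht, Matrix.mul_smul, Matrix.mul_smul, hPC,
          smul_smul]
        nth_rewrite 1 [← one_smul ℂ (addStrand (pJW (k + 1)) * cupLast k)]
        rw [← add_smul]
        convert zero_smul ℂ _
        field_simp
        ring
      change pJW (k + 2) * pJW (k + 2) = pJW (k + 2)
      nth_rewrite 2 [hp]
      rw [Matrix.mul_add, habs, Matrix.mul_smul, ← Matrix.mul_assoc, ← Matrix.mul_assoc, habs,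
        ← Matrix.mul_assoc, hann, Matrix.zero_mul, Matrix.zero_mul, smul_zero, add_zero]
    · rw [ht']
      push_cast
      ring_nf

/-- Partial trace formula for Jones-Wenzl projectors: for `m ≥ 2`
(here `m = k + 1` with `k ≥ 1`),
`(id^{⊗(m-1)} ⊗ cap) ∘ (p_m ⊗ id) ∘ (id^{⊗(m-1)} ⊗ cup) = -((m+1)/m) p_{m-1}`. -/
theorem JW_partial_trace (k : ℕ) (hk : 1 ≤ k) :
    tensMor (1 : Op k) capM * tensMor (pJW (k + 1)) (1 : Op 1) * tensMor (1 : Op k) cupM =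
      (-(((k : ℂ) + 2) / ((k : ℂ) + 1))) • pJW k := by
  exact (pJW_idempotent_and_absorb_and_partialTrace k).2.2
end
end
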